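/- Let G be a countable amenable group, X a compact metric space, and F a continuous bundle random dynamical system over a measure-preserving dynamical system (Ω,𝓕,ℙ,G). Then the RDS F is Banach-mean equicontinuous if and only if it is Weyl-mean equicontinuous. -/

import Mathlib

open Filter MeasureTheory Topology Metric Set ENNReal
open scoped symmDiff Classical

/-- `Φ` is a (left) Følner sequence of nonempty finite subsets of `G`. -/
def IsFolner {G : Type*} [Group G] (Φ : ℕ → Finset G) : Prop :=
  (∀ n, (Φ n).Nonempty) ∧
    ∀ g : G,
      Tendsto (fun n => ((((Φ n).image fun t => g * t) ∆ Φ n).card : ℝ) / ((Φ n).card : ℝ))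
        atTop (𝓝 0)

/-- The upper Banach density `BD*(E)` of a subset `E` of an amenable group `G`. -/
noncomputable def upperBanachDensity {G : Type*} [Group G] (E : Set G) : ℝ≥0∞ :=
  ⨆ (Φ : ℕ → Finset G) (_ : IsFolner Φ),
    Filter.limsup
      (fun n => (((Φ n).filter fun g => g ∈ E).card : ℝ≥0∞) / ((Φ n).card : ℝ≥0∞)) atTop

/-- A continuous bundle random dynamical system over the measure-preserving dynamical
system given by the measure-preserving action of `G` on the probability space `(Ω, μ)`,
with fibers `E ω ⊆ X` and fiber maps `F g ω : E ω → E (g • ω)`. -/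
structure RDS (G : Type*) [Group G] (Ω : Type*) [MeasurableSpace Ω] [MulAction G Ω]
    (μ : Measure Ω) (X : Type*) [MetricSpace X] [MeasurableSpace X] [BorelSpace X] where
  E : Ω → Set X
  F : G → Ω → X → X
  measurePreserving_smul : ∀ g : G, MeasurePreserving (fun ω : Ω => g • ω) μ μ
  measurableSet_carrier : MeasurableSet {p : Ω × X | p.2 ∈ E p.1}
  mapsTo : ∀ (g : G) (ω : Ω), Set.MapsTo (F g ω) (E ω) (E (g • ω))
  one_apply : ∀ (ω : Ω), ∀ x ∈ E ω, F 1 ω x = x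
  measurable_F : ∀ g : G, Measurable fun p : {p : Ω × X // p.2 ∈ E p.1} => F g p.1.1 p.1.2
  cocycle : ∀ (g₁ g₂ : G) (ω : Ω), ∀ x ∈ E ω, F g₂ (g₁ • ω) (F g₁ ω x) = F (g₂ * g₁) ω x
  ae_fiber : ∀ᵐ ω ∂μ, (E ω).Nonempty ∧ IsCompact (E ω) ∧ ∀ g : G, ContinuousOn (F g ω) (E ω)

namespace RDS

variable {G : Type*} [Group G] {Ω : Type*} [MeasurableSpace Ω] [MulAction G Ω]
  {μ : Measure Ω} {X : Type*} [MetricSpace X] [MeasurableSpace X] [BorelSpace X]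
  (S : RDS G Ω μ X)

/-- The carrier `𝓔 ⊆ Ω × X` of the RDS. -/
def carrier : Set (Ω × X) := {p : Ω × X | p.2 ∈ S.E p.1}

/-- `d̃(tx, ty) := sup_ω d(F_{t,ω} x, F_{t,ω} y)` when `x, y` lie in a common fiber,
and `∞` otherwise. -/
noncomputable def dt (t : G) (x y : X) : ℝ≥0∞ :=
  if ∃ ω : Ω, x ∈ S.E ω ∧ y ∈ S.E ω then
    ⨆ ω ∈ {ω : Ω | x ∈ S.E ω ∧ y ∈ S.E ω}, edist (S.F t ω x) (S.F t ω y)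
  else ⊤

/-- `D^{(r)}_𝓕(x,y) := limsup_n (1/|Φ n|) Σ_{t ∈ Φ n} d̃(tx,ty)`. -/
noncomputable def DFol (Φ : ℕ → Finset G) (x y : X) : ℝ≥0∞ :=
  Filter.limsup (fun n => (∑ t ∈ Φ n, S.dt t x y) / ((Φ n).card : ℝ≥0∞)) atTop

/-- The Weyl pseudometric `D^{(r)}(x,y)`, the sup over all Følner sequences. -/
noncomputable def DW (x y : X) : ℝ≥0∞ :=
  ⨆ (Φ : ℕ → Finset G) (_ : IsFolner Φ), S.DFol Φ x y

/-- The Banach pseudometric `D̄^{(r)}(x,y) := inf_K sup_g (1/|K|) Σ_{t ∈ Kg} d̃(tx,ty)`. -/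
noncomputable def DB (x y : X) : ℝ≥0∞ :=
  ⨅ (K : Finset G) (_ : K.Nonempty),
    ⨆ g : G, (∑ t ∈ K.image fun k => k * g, S.dt t x y) / ((K.card : ℝ≥0∞))

/-- Weyl-mean equicontinuity of the RDS. -/
def WME : Prop :=
  ∀ ε : ℝ, 0 < ε → ∃ δ : ℝ, 0 < δ ∧ ∀ (ω : Ω) (x y : X),
    x ∈ S.E ω → y ∈ S.E ω → dist x y < δ → S.DW x y < ENNReal.ofReal ε

/-- Banach-mean equicontinuity of the RDS. -/
def BME : Prop :=
  ∀ ε : ℝ, 0 < ε → ∃ δ : ℝ, 0 < δ ∧ ∀ (ω : Ω) (x y : X),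
    x ∈ S.E ω → y ∈ S.E ω → dist x y < δ → S.DB x y < ENNReal.ofReal ε

/-- Mean-L-stability: points starting close stay `ε`-close outside a set of
upper Banach density less than `ε`. -/
def MeanLStable : Prop :=
  ∀ ε : ℝ, 0 < ε → ∃ δ : ℝ, 0 < δ ∧ ∀ (ω : Ω) (x y : X),
    x ∈ S.E ω → y ∈ S.E ω → dist x y < δ →
      upperBanachDensity {g : G | ENNReal.ofReal ε ≤ S.dt g x y} < ENNReal.ofReal ε

/-- `Ĥ^{(r)}_{𝓕,ω}(x,y)`. -/
noncomputable def HFol (Φ : ℕ → Finset G) (ω : Ω) (x y : X) : ℝ≥0∞ :=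
  if x ∈ S.E ω ∧ y ∈ S.E ω then
    Filter.limsup
      (fun n => (∑ t ∈ Φ n, edist (S.F t ω x) (S.F t ω y)) / ((Φ n).card : ℝ≥0∞)) atTop
  else ⊤

/-- `Ĥ^{(r)}_ω(x,y)`, the sup over all Følner sequences of `Ĥ^{(r)}_{𝓕,ω}(x,y)`. -/
noncomputable def HW (ω : Ω) (x y : X) : ℝ≥0∞ :=
  ⨆ (Φ : ℕ → Finset G) (_ : IsFolner Φ), S.HFol Φ ω x y

/-- `Ĥ^{(r)}(x,y) := sup_ω Ĥ^{(r)}_ω(x,y)`. -/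
noncomputable def Hsup (x y : X) : ℝ≥0∞ := ⨆ ω : Ω, S.HW ω x y

/-- Weyl-mean sensitivity of the RDS. -/
def WeylMeanSensitive : Prop :=
  ∃ δ : ℝ, 0 < δ ∧ ∀ (x : X) (ε : ℝ), 0 < ε →
    ∃ (ω : Ω) (y : X), y ∈ S.E ω ∩ Metric.ball x ε ∧ ENNReal.ofReal δ < S.HW ω x y

/-- The set `𝔼_{ω,ε}` of points of `E ω` around which the Weyl pseudometric is
uniformly `< ε` on a small relative ball. -/
def EE (ω : Ω) (ε : ℝ) : Set X :=
  {x ∈ S.E ω | ∃ δ : ℝ, 0 < δ ∧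
    ∀ y ∈ Metric.ball x δ ∩ S.E ω, ∀ z ∈ Metric.ball x δ ∩ S.E ω,
      S.DW y z < ENNReal.ofReal ε}

/-- The set `𝔼` of Weyl-mean equicontinuous points of the RDS. -/
def meanEqPts : Set X :=
  {x : X | ∀ ε : ℝ, 0 < ε → ∃ δ : ℝ, 0 < δ ∧ ∀ (ω : Ω) (y : X),
    y ∈ S.E ω → dist x y < δ → S.DW x y < ENNReal.ofReal ε}

end RDS

/-- `D_𝓕(x,y)` for a (deterministic) group action `T` of `G` on `K`. -/
noncomputable def actDFol {G K : Type*} [Group G] [PseudoMetricSpace K]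
    (T : G → K → K) (Φ : ℕ → Finset G) (x y : K) : ℝ≥0∞ :=
  Filter.limsup (fun n => (∑ t ∈ Φ n, edist (T t x) (T t y)) / ((Φ n).card : ℝ≥0∞)) atTop

/-- The Weyl pseudometric `D(x,y)` for a group action. -/
noncomputable def actDW {G K : Type*} [Group G] [PseudoMetricSpace K]
    (T : G → K → K) (x y : K) : ℝ≥0∞ :=
  ⨆ (Φ : ℕ → Finset G) (_ : IsFolner Φ), actDFol T Φ x y

/-- The Banach pseudometric `D̄(x,y)` for a group action. -/
noncomputable def actDB {G K : Type*} [Group G] [PseudoMetricSpace K]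
    (T : G → K → K) (x y : K) : ℝ≥0∞ :=
  ⨅ (F : Finset G) (_ : F.Nonempty),
    ⨆ g : G, (∑ t ∈ F.image fun k => k * g, edist (T t x) (T t y)) / ((F.card : ℝ≥0∞))

/-- The set of Weyl-mean equicontinuous points of a group action. -/
def actMeanEqPts {G K : Type*} [Group G] [PseudoMetricSpace K]
    (T : G → K → K) : Set K :=
  {x : K | ∀ ε : ℝ, 0 < ε → ∃ δ : ℝ, 0 < δ ∧
    ∀ y : K, dist x y < δ → actDW T x y < ENNReal.ofReal ε}

theorem IsFolner.image_mul_right {G : Type*} [Group G] {Φ : ℕ → Finset G} (hΦ : IsFolner Φ)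
    (g : ℕ → G) : IsFolner fun n => (Φ n).image fun t => t * g n := by
  refine ⟨fun n => (hΦ.1 n).image _, fun h => (hΦ.2 h).congr fun n => ?_⟩
  have hinj : Function.Injective fun t : G => t * g n := mul_left_injective _
  have hcomm : (((Φ n).image fun t => t * g n).image fun t => h * t) =
      ((Φ n).image fun t => h * t).image fun t => t * g n := by
    simp only [Finset.image_image, Function.comp_def, mul_assoc]
  rw [hcomm, ← Finset.image_symmDiff _ _ hinj, Finset.card_image_of_injective _ hinj,
    Finset.card_image_of_injective _ hinj]

theorem IsFolner.tendsto_card_symmDiff_div {G : Type*} [Group G] {Φ : ℕ → Finset G}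
    (hΦ : IsFolner Φ) (g : G) :
    Tendsto (fun n => ((((Φ n).image fun t => g * t) ∆ Φ n).card : ℝ≥0∞) / ((Φ n).card : ℝ≥0∞))
      atTop (𝓝 0) := by
  have h := ENNReal.tendsto_ofReal (hΦ.2 g)
  rw [ENNReal.ofReal_zero] at h
  refine h.congr fun n => ?_
  have hpos : (0 : ℝ) < (Φ n).card := by exact_mod_cast (hΦ.1 n).card_pos
  rw [ENNReal.ofReal_div_of_pos hpos, ENNReal.ofReal_natCast, ENNReal.ofReal_natCast]

theorem Finset.sum_le_sum_add_card_symmDiff_mul {α : Type*} (f : α → ℝ≥0∞) {M : ℝ≥0∞}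
    (hf : ∀ a, f a ≤ M) (A B : Finset α) :
    ∑ t ∈ B, f t ≤ ∑ t ∈ A, f t + ((A ∆ B).card : ℝ≥0∞) * M := by
  have hsub : B ⊆ A ∪ A ∆ B := by
    intro b hb
    by_cases ha : b ∈ A
    · exact Finset.mem_union_left _ ha
    · exact Finset.mem_union_right _ (Finset.mem_symmDiff.2 (Or.inr ⟨hb, ha⟩))
  calc ∑ t ∈ B, f t ≤ ∑ t ∈ A ∪ A ∆ B, f t := Finset.sum_le_sum_of_subset hsub
    _ ≤ ∑ t ∈ A, f t + ∑ t ∈ A ∆ B, f t := by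
      rw [← Finset.sum_union_inter]
      exact le_self_add
    _ ≤ _ := by
      gcongr
      simpa using Finset.sum_le_card_nsmul (A ∆ B) f M fun a _ => hf a

/-- Averages along a Følner sequence are bounded by the supremum of the averages over the right
translates of any nonempty finite set. -/
theorem IsFolner.limsup_average_le {G : Type*} [Group G] {Φ : ℕ → Finset G} (hΦ : IsFolner Φ)
    {f : G → ℝ≥0∞} {M : ℝ≥0∞} (hM : M ≠ ⊤) (hf : ∀ g, f g ≤ M) {K : Finset G}
    (hK : K.Nonempty) :
    limsup (fun n => (∑ t ∈ Φ n, f t) / ((Φ n).card : ℝ≥0∞)) atTop ≤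
      ⨆ g : G, (∑ t ∈ K.image fun k => k * g, f t) / (K.card : ℝ≥0∞) := by
  set c := ⨆ g : G, (∑ t ∈ K.image fun k => k * g, f t) / (K.card : ℝ≥0∞) with hc
  have hK0 : (K.card : ℝ≥0∞) ≠ 0 := by exact_mod_cast hK.card_ne_zero
  have hKt : (K.card : ℝ≥0∞) ≠ ⊤ := ENNReal.natCast_ne_top _
  have hsum (g : G) : ∑ k ∈ K, f (k * g) ≤ c * K.card := by
    rw [← ENNReal.div_le_iff hK0 hKt, ← Finset.sum_image (mul_left_injective g).injOn]
    exact le_iSup (fun g : G => (∑ t ∈ K.image fun k => k * g, f t) / (K.card : ℝ≥0∞)) g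
  let e : ℕ → ℝ≥0∞ := fun n => (∑ k ∈ K,
    ((((Φ n).image fun t => k * t) ∆ Φ n).card : ℝ≥0∞) / ((Φ n).card : ℝ≥0∞)) * M
  have he : Tendsto e atTop (𝓝 0) := by
    have h := ENNReal.Tendsto.mul_const (b := M)
      (tendsto_finsetSum K fun k _ => hΦ.tendsto_card_symmDiff_div k) (Or.inr hM)
    rwa [Finset.sum_const_zero, zero_mul] at h
  have key (n : ℕ) : (∑ t ∈ Φ n, f t) / ((Φ n).card : ℝ≥0∞) ≤ c + e n / K.card := by
    have hn0 : ((Φ n).card : ℝ≥0∞) ≠ 0 := by exact_mod_cast (hΦ.1 n).card_ne_zero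
    have hnt : ((Φ n).card : ℝ≥0∞) ≠ ⊤ := ENNReal.natCast_ne_top _
    have htrans (k : G) : ∑ t ∈ Φ n, f t ≤ ∑ t ∈ Φ n, f (k * t) +
        ((((Φ n).image fun t => k * t) ∆ Φ n).card : ℝ≥0∞) * M := by
      rw [← Finset.sum_image (f := f) (mul_right_injective k).injOn]
      exact Finset.sum_le_sum_add_card_symmDiff_mul f hf _ _
    have h1 : (K.card : ℝ≥0∞) * ∑ t ∈ Φ n, f t ≤ (Φ n).card * (c * K.card) +
        ∑ k ∈ K, ((((Φ n).image fun t => k * t) ∆ Φ n).card : ℝ≥0∞) * M := by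
      calc (K.card : ℝ≥0∞) * ∑ t ∈ Φ n, f t = ∑ k ∈ K, ∑ t ∈ Φ n, f t := by simp
        _ ≤ ∑ k ∈ K, (∑ t ∈ Φ n, f (k * t) +
            ((((Φ n).image fun t => k * t) ∆ Φ n).card : ℝ≥0∞) * M) :=
          Finset.sum_le_sum fun k _ => htrans k
        _ = ∑ t ∈ Φ n, ∑ k ∈ K, f (k * t) +
            ∑ k ∈ K, ((((Φ n).image fun t => k * t) ∆ Φ n).card : ℝ≥0∞) * M := by
          rw [Finset.sum_add_distrib, Finset.sum_comm]
        _ ≤ _ := by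
          gcongr
          simpa using Finset.sum_le_card_nsmul (Φ n) _ _ fun t _ => hsum t
    have h2 : e n * (Φ n).card =
        ∑ k ∈ K, ((((Φ n).image fun t => k * t) ∆ Φ n).card : ℝ≥0∞) * M := by
      simp only [e]
      rw [mul_right_comm, Finset.sum_mul, Finset.sum_mul]
      exact Finset.sum_congr rfl fun k _ => by rw [ENNReal.div_mul_cancel hn0 hnt]
    rw [ENNReal.div_le_iff hn0 hnt, ← ENNReal.mul_le_mul_iff_right hK0 hKt]
    refine h1.trans_eq ?_
    rw [← h2, add_mul, mul_add, ← mul_assoc (K.card : ℝ≥0∞) (e n / _),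
      ENNReal.mul_div_cancel hK0 hKt]
    ring
  have hlim : Tendsto (fun n => c + e n / K.card) atTop (𝓝 c) := by
    simpa using (ENNReal.Tendsto.div_const he (Or.inr hK0)).const_add c
  exact (limsup_le_limsup (Eventually.of_forall key)).trans_eq hlim.limsup_eq

namespace RDS

variable {G : Type*} [Group G] {Ω : Type*} [MeasurableSpace Ω] [MulAction G Ω]
  {μ : Measure Ω} {X : Type*} [MetricSpace X] [MeasurableSpace X] [BorelSpace X]
  (S : RDS G Ω μ X)

theorem dt_le_ediam {ω : Ω} {x y : X} (hx : x ∈ S.E ω) (hy : y ∈ S.E ω) (t : G) :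
    S.dt t x y ≤ ediam (univ : Set X) := by
  rw [dt, if_pos ⟨ω, hx, hy⟩]
  exact iSup₂_le fun _ _ => edist_le_ediam_of_mem (mem_univ _) (mem_univ _)

theorem DW_le_DB [CompactSpace X] {ω : Ω} {x y : X} (hx : x ∈ S.E ω) (hy : y ∈ S.E ω) :
    S.DW x y ≤ S.DB x y :=
  iSup₂_le fun _ hΦ => le_iInf₂ fun _ hK =>
    hΦ.limsup_average_le isCompact_univ.isBounded.ediam_ne_top (S.dt_le_ediam hx hy) hK

theorem DB_le_DW (hG : ∃ Φ : ℕ → Finset G, IsFolner Φ) (x y : X) : S.DB x y ≤ S.DW x y := by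
  obtain ⟨Φ, hΦ⟩ := hG
  refine le_of_forall_lt fun c hc => ?_
  obtain ⟨d, hcd, hd⟩ := exists_between hc
  have hex (n : ℕ) : ∃ g : G,
      d < (∑ t ∈ (Φ n).image fun k => k * g, S.dt t x y) / ((Φ n).card : ℝ≥0∞) :=
    lt_iSup_iff.1 (hd.trans_le (iInf₂_le (Φ n) (hΦ.1 n)))
  choose g hg using hex
  have hle : d ≤ S.DFol (fun n => (Φ n).image fun t => t * g n) x y := by
    refine le_limsup_of_frequently_le (Frequently.of_forall fun n => ?_)
    rw [Finset.card_image_of_injective _ (mul_left_injective (g n))]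
    exact (hg n).le
  exact hcd.trans_le (hle.trans (le_iSup₂ (f := fun Ψ (_ : IsFolner Ψ) => S.DFol Ψ x y) _
    (hΦ.image_mul_right g)))

theorem DB_eq_DW [CompactSpace X] (hG : ∃ Φ : ℕ → Finset G, IsFolner Φ) {ω : Ω} {x y : X}
    (hx : x ∈ S.E ω) (hy : y ∈ S.E ω) : S.DB x y = S.DW x y :=
  (S.DB_le_DW hG x y).antisymm (S.DW_le_DB hx hy)

end RDS

/-- An RDS over a countable amenable group is Banach-mean equicontinuous
iff it is Weyl-mean equicontinuous. -/
theorem bme_iff_wme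
    {G : Type*} [Group G] [Countable G]
    {Ω : Type*} [MeasurableSpace Ω] [MulAction G Ω]
    {μ : Measure Ω} [IsProbabilityMeasure μ]
    {X : Type*} [MetricSpace X] [CompactSpace X] [MeasurableSpace X] [BorelSpace X]
    (hG : ∃ Φ : ℕ → Finset G, IsFolner Φ)
    (S : RDS G Ω μ X) :
    S.BME ↔ S.WME := by
  unfold RDS.BME RDS.WME
  refine forall₂_congr fun ε _ => exists_congr fun δ => and_congr_right fun _ =>
    forall₃_congr fun ω x y => forall₃_congr fun hx hy _ => ?_
  rw [S.DB_eq_DW hG hx hy]
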